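/- arXiv:2502.13118 — 2 statements merged into one kernel-verified Lean document; each statement's English description precedes it below -/
import Mathlib

section
/- For every n ≥ 3, the Grundy value of the cycle C_n in the Normal Domination Game is equal to 1 if n % 4 = 3, and is equal to 0 otherwise. -/
open SimpleGraph Finset

/-- A vertex `u` is dominated by the selected set `S` if it lies in the closed
neighborhood of some selected vertex. -/
def Dominated {V : Type} (G : SimpleGraph V) (S : Finset V) (u : V) : Prop :=
  ∃ s ∈ S, u = s ∨ G.Adj s u

/-- A vertex `v` is playable in position `S` if some vertex of the closed
neighborhood of `v` is not dominated by `S`. -/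
def Playable {V : Type} (G : SimpleGraph V) (S : Finset V) (v : V) : Prop :=
  ∃ u, (u = v ∨ G.Adj v u) ∧ ¬ Dominated G S u

lemma Playable.not_mem {V : Type} {G : SimpleGraph V} {S : Finset V} {v : V}
    (h : Playable G S v) : v ∉ S := by
  intro hv
  obtain ⟨u, hu, hnd⟩ := h
  exact hnd ⟨v, hv, hu.imp id (fun a => a)⟩

lemma Playable.card_lt {V : Type} [Fintype V] [DecidableEq V]
    {G : SimpleGraph V} {S : Finset V} {v : V} (h : Playable G S v) :
    (Finset.univ \ insert v S).card < (Finset.univ \ S).card := by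
  apply Finset.card_lt_card
  refine ⟨Finset.sdiff_subset_sdiff (le_refl _) (Finset.subset_insert v S), ?_⟩
  intro hsub
  have hv : v ∈ Finset.univ \ S := by simp [h.not_mem]
  have := hsub hv
  simp at this

/-- The Grundy value (nimber) of a position of the Normal Domination Game:
the minimum excludant (least natural number not attained) of the Grundy values
of the positions reachable in one move (i.e. by selecting a playable vertex). -/
noncomputable def grundy {V : Type} [Fintype V] [DecidableEq V]
    (G : SimpleGraph V) (S : Finset V) : ℕ :=
  sInf {m : ℕ |
    m ∉ Set.range fun v : {v : V // Playable G S v} => grundy G (insert v.1 S)}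
termination_by (Finset.univ \ S).card
decreasing_by exact v.2.card_lt

/-- The set of vertices not dominated by `S`. -/
noncomputable def undominated {V : Type} [Fintype V] (G : SimpleGraph V) (S : Finset V) :
    Finset V := by
  classical exact Finset.univ.filter fun u => ¬ Dominated G S u

lemma mem_undominated {V : Type} [Fintype V] {G : SimpleGraph V} {S : Finset V} {u : V} :
    u ∈ undominated G S ↔ ¬ Dominated G S u := by
  simp [undominated]

lemma mex_set_nonempty {V : Type} [Fintype V] [DecidableEq V]
    (G : SimpleGraph V) (S : Finset V) :
    {m : ℕ | m ∉ Set.range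
      fun v : {v : V // Playable G S v} => grundy G (insert v.1 S)}.Nonempty := by
  have hfin := Set.finite_range fun v : {v : V // Playable G S v} => grundy G (insert v.1 S)
  exact hfin.infinite_compl.nonempty

lemma grundy_eq_zero_iff {V : Type} [Fintype V] [DecidableEq V]
    (G : SimpleGraph V) (S : Finset V) :
    grundy G S = 0 ↔ ∀ v, Playable G S v → grundy G (insert v S) ≠ 0 := by
  rw [grundy, Nat.sInf_eq_zero, or_iff_left (mex_set_nonempty G S).ne_empty]
  simp

lemma grundy_eq_one {V : Type} [Fintype V] [DecidableEq V]
    {G : SimpleGraph V} {S : Finset V} {v : V} (hv : Playable G S v)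
    (h : ∀ v, Playable G S v → grundy G (insert v S) = 0) : grundy G S = 1 := by
  have hpos : grundy G S ≠ 0 := fun h0 => (grundy_eq_zero_iff G S).1 h0 v hv (h v hv)
  have hle : grundy G S ≤ 1 := by
    rw [grundy]
    apply Nat.sInf_le
    rintro ⟨⟨w, hw⟩, hw1⟩
    simp [h w hw] at hw1
  omega

section Cycle

variable {m : ℕ}

/-- `R` is the set of vertices of odd rank in the runs of consecutive elements of `U`. -/
def IsAlternating (R U : Finset (Fin (m + 3))) : Prop :=
  ∀ k, k ∈ R ↔ k ∈ U ∧ k - 1 ∉ R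

lemma IsAlternating.subset {R U : Finset (Fin (m + 3))} (h : IsAlternating R U) : R ⊆ U :=
  fun k hk => ((h k).1 hk).1

lemma IsAlternating.succ_mem_iff {R U : Finset (Fin (m + 3))} (h : IsAlternating R U)
    (k : Fin (m + 3)) : k + 1 ∈ R ↔ k + 1 ∈ U ∧ k ∉ R := by
  simpa using h (k + 1)

lemma eq_univ_of_succ_closed {T : Finset (Fin (m + 3))} (hne : T.Nonempty)
    (h : ∀ u ∈ T, u + 1 ∈ T) : T = Finset.univ := by
  obtain ⟨u, hu⟩ := hne
  have key : ∀ k : ℕ, u + Fin.ofNat (m + 3) k ∈ T := by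
    intro k
    induction k with
    | zero => simpa using hu
    | succ k ih =>
      have := h _ ih
      rwa [add_assoc, show Fin.ofNat (m + 3) k + 1 = Fin.ofNat (m + 3) (k + 1) by
        ext; simp [Fin.val_add]] at this
  ext w
  have := key (w - u).val
  simpa using this

lemma exists_isAlternating (U : Finset (Fin (m + 3))) (hU : U ≠ Finset.univ) :
    ∃ R, IsAlternating R U := by
  induction U using Finset.strongInduction with
  | H U ih =>
    rcases U.eq_empty_or_nonempty with rfl | hne
    · exact ⟨∅, by intro k; simp⟩
    · obtain ⟨u, hu, hu1⟩ : ∃ u ∈ U, u + 1 ∉ U := by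
        by_contra! hc
        exact hU (eq_univ_of_succ_closed hne hc)
      obtain ⟨R, hR⟩ := ih (U.erase u) (Finset.erase_ssubset hu)
        (fun hc => by have := Finset.mem_univ u; rw [← hc] at this; simp at this)
      have huR : u ∉ R := fun h => by simpa using hR.subset h
      have hne1 : u - 1 ≠ u := by simp
      by_cases hp : u - 1 ∈ R
      · refine ⟨R, fun k => ?_⟩
        rcases eq_or_ne k u with rfl | hk
        · simp [huR, hp]
        · rw [hR k]; simp [hk]
      · refine ⟨insert u R, fun k => ?_⟩
        rcases eq_or_ne k u with rfl | hk
        · simp [hu, hp]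
        · have h1 : k ∈ U → k - 1 ≠ u := by
            rintro hkU rfl
            simp [hkU] at hu1
          have := hR k
          simp only [Finset.mem_erase, Finset.mem_insert, hk, false_or] at this ⊢
          tauto

/-- The closed neighborhood of `v` in the cycle. -/
def cycleNbhd (v : Fin (m + 3)) : Finset (Fin (m + 3)) := {v - 1, v, v + 1}

lemma mem_cycleNbhd {u v : Fin (m + 3)} :
    u ∈ cycleNbhd v ↔ u = v - 1 ∨ u = v ∨ u = v + 1 := by
  simp [cycleNbhd]

lemma mem_cycleNbhd_iff_adj {u v : Fin (m + 3)} :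
    u ∈ cycleNbhd v ↔ u = v ∨ (SimpleGraph.cycleGraph (m + 3)).Adj v u := by
  rw [mem_cycleNbhd, SimpleGraph.cycleGraph_adj]
  have h1 : v - u = 1 ↔ u = v - 1 := by
    rw [sub_eq_iff_eq_add, eq_sub_iff_add_eq, add_comm 1 u, eq_comm]
  have h2 : u - v = 1 ↔ u = v + 1 := by rw [sub_eq_iff_eq_add, add_comm 1 v]
  rw [h1, h2]
  tauto

lemma dominated_cycle_iff {S : Finset (Fin (m + 3))} {u : Fin (m + 3)} :
    Dominated (SimpleGraph.cycleGraph (m + 3)) S u ↔ ∃ s ∈ S, u ∈ cycleNbhd s := by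
  simp only [Dominated, mem_cycleNbhd_iff_adj]

lemma playable_cycle_iff {S : Finset (Fin (m + 3))} {v : Fin (m + 3)} :
    Playable (SimpleGraph.cycleGraph (m + 3)) S v ↔
      ∃ u ∈ cycleNbhd v, u ∈ undominated (SimpleGraph.cycleGraph (m + 3)) S := by
  simp only [Playable, mem_cycleNbhd_iff_adj, mem_undominated]

lemma undominated_cycle_insert (S : Finset (Fin (m + 3))) (v : Fin (m + 3)) :
    undominated (SimpleGraph.cycleGraph (m + 3)) (insert v S) =
      undominated (SimpleGraph.cycleGraph (m + 3)) S \ cycleNbhd v := by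
  ext u
  simp only [mem_undominated, dominated_cycle_iff, Finset.mem_sdiff, Finset.mem_insert]
  simp only [or_and_right, exists_or, exists_eq_left]
  rw [not_or, and_comm]

lemma undominated_ne_univ {S : Finset (Fin (m + 3))} (hS : S.Nonempty) :
    undominated (SimpleGraph.cycleGraph (m + 3)) S ≠ Finset.univ := by
  obtain ⟨s, hs⟩ := hS
  intro h
  have h1 : s ∈ undominated (SimpleGraph.cycleGraph (m + 3)) S := h ▸ Finset.mem_univ s
  exact mem_undominated.1 h1 ⟨s, hs, Or.inl rfl⟩

lemma succ_notMem_undominated {S : Finset (Fin (m + 3))} {u : Fin (m + 3)}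
    (hu : u - 1 ∈ undominated (SimpleGraph.cycleGraph (m + 3)) S)
    (hu1 : u ∉ undominated (SimpleGraph.cycleGraph (m + 3)) S) :
    u + 1 ∉ undominated (SimpleGraph.cycleGraph (m + 3)) S := by
  simp only [mem_undominated, dominated_cycle_iff, not_not, mem_cycleNbhd] at *
  obtain ⟨s, hs, h⟩ := hu1
  refine ⟨s, hs, ?_⟩
  rcases h with rfl | rfl | rfl
  · simp
  · simp
  · exact absurd ⟨s, hs, by simp⟩ hu

lemma card_eq_card_sdiff_cycleNbhd (X : Finset (Fin (m + 3))) (v : Fin (m + 3)) :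
    X.card = (X \ cycleNbhd v).card + ((if v - 1 ∈ X then 1 else 0) +
      ((if v ∈ X then 1 else 0) + (if v + 1 ∈ X then 1 else 0))) := by
  have h1 : v - 1 ≠ v := by simp
  have h2 : v ≠ v + 1 := by simp
  have h3 : v - 1 ≠ v + 1 := by
    intro h
    rw [sub_eq_iff_eq_add, add_assoc, left_eq_add] at h
    have := congrArg Fin.val h
    simp [Fin.val_add, Nat.mod_eq_of_lt] at this
  rw [← Finset.card_sdiff_add_card_inter X (cycleNbhd v), Finset.inter_comm,
    ← Finset.filter_mem_eq_inter, Finset.card_filter, cycleNbhd,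
    Finset.sum_insert (by simp [h1, h3]), Finset.sum_insert (by simp), Finset.sum_singleton]

lemma IsAlternating.sdiff_cycleNbhd {R U : Finset (Fin (m + 3))} (h : IsAlternating R U)
    {v : Fin (m + 3)} (hv : v + 1 ∈ R → v + 1 + 1 ∉ U) :
    IsAlternating (R \ cycleNbhd v) (U \ cycleNbhd v) := by
  intro k
  have hk := h k
  simp only [Finset.mem_sdiff]
  by_cases hkD : k ∈ cycleNbhd v
  · simp [hkD]
  · have key : k ∈ U → k - 1 ∈ R → k - 1 ∉ cycleNbhd v := by
      intro hkU hkR hm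
      rw [mem_cycleNbhd] at hm hkD
      rcases hm with hm | hm | hm
      · exact hkD (Or.inr (Or.inl (sub_left_injective hm)))
      · exact hkD (Or.inr (Or.inr (sub_eq_iff_eq_add.1 hm)))
      · rw [hm] at hkR
        rw [sub_eq_iff_eq_add] at hm
        exact hv hkR (hm ▸ hkU)
    tauto

lemma IsAlternating.card_eq {R U : Finset (Fin (m + 3))} (h : IsAlternating R U) :
    R.card = (U \ R).card + (R.filter fun u => u + 1 ∉ U).card := by
  have hb : (R.filter fun u => u + 1 ∈ U).card = (U \ R).card := by
    apply Finset.card_bij (fun u _ => u + 1)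
    · intro u hu
      rw [Finset.mem_filter] at hu
      simp [hu.2, h.succ_mem_iff, hu.1]
    · intro a _ b _ hab
      simpa using hab
    · intro b hb
      rw [Finset.mem_sdiff] at hb
      refine ⟨b - 1, ?_, by simp⟩
      have := h b
      simp only [Finset.mem_filter, sub_add_cancel]
      tauto
  rw [← hb, Finset.card_filter_add_card_filter_not]

/-- From a position without both color classes even, some move makes both of them even. -/
lemma exists_move_even {S : Finset (Fin (m + 3))} (hS : S.Nonempty) {R : Finset (Fin (m + 3))}
    (h : IsAlternating R (undominated (SimpleGraph.cycleGraph (m + 3)) S))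
    (hodd : ¬ (Even R.card ∧
      Even (undominated (SimpleGraph.cycleGraph (m + 3)) S \ R).card)) :
    ∃ v, Playable (SimpleGraph.cycleGraph (m + 3)) S v ∧
      IsAlternating (R \ cycleNbhd v)
        (undominated (SimpleGraph.cycleGraph (m + 3)) (insert v S)) ∧
      Even (R \ cycleNbhd v).card ∧
      Even (undominated (SimpleGraph.cycleGraph (m + 3)) (insert v S) \
        (R \ cycleNbhd v)).card := by
  simp only [undominated_cycle_insert, playable_cycle_iff]
  have hgap := @succ_notMem_undominated m S
  have hne := undominated_ne_univ hS
  generalize undominated (SimpleGraph.cycleGraph (m + 3)) S = U at *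
  have hsub : ∀ v, (U \ cycleNbhd v) \ (R \ cycleNbhd v) = (U \ R) \ cycleNbhd v := by
    intro v; ext; simp only [Finset.mem_sdiff]; tauto
  have hRU : ∀ {k}, k ∈ R → k ∈ U := fun hk => h.subset hk
  simp only [hsub]
  by_cases hB : Even (U \ R).card
  · obtain ⟨u, hu⟩ : (R.filter fun u => u + 1 ∉ U).Nonempty := by
      rw [← Finset.card_pos]
      have := h.card_eq
      by_contra hc
      rw [show R.card = (U \ R).card by omega] at hodd
      exact hodd ⟨hB, hB⟩
    rw [Finset.mem_filter] at hu
    obtain ⟨huR, hu1⟩ := hu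
    have hu2 : u + 1 + 1 ∉ U := hgap (by simpa using hRU huR) hu1
    have hu1R : u + 1 ∉ R := fun hc => hu1 (hRU hc)
    have hu2R : u + 1 + 1 ∉ R := fun hc => hu2 (hRU hc)
    refine ⟨u + 1, ⟨u, by simp [mem_cycleNbhd], hRU huR⟩,
      h.sdiff_cycleNbhd (fun hc => absurd hc hu2R), ?_⟩
    have c1 := card_eq_card_sdiff_cycleNbhd R (u + 1)
    have c2 := card_eq_card_sdiff_cycleNbhd (U \ R) (u + 1)
    simp [huR, hu1, hu1R, hu2, hu2R] at c1 c2
    rw [← c2]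
    refine ⟨?_, hB⟩
    simp only [Nat.even_iff] at *
    omega
  · obtain ⟨b, hb⟩ : (U \ R).Nonempty := by
      rw [Finset.nonempty_iff_ne_empty]
      rintro hc
      simp [hc] at hB
    rw [Finset.mem_sdiff] at hb
    obtain ⟨u, hu, hp, hu1⟩ : ∃ u, u ∈ U ∧ u - 1 ∈ U ∧ u + 1 ∉ U := by
      by_contra! hc
      have huniv : U.filter (fun u => u - 1 ∈ U) = Finset.univ := by
        apply eq_univ_of_succ_closed
        · refine ⟨b, ?_⟩
          have := h b
          have := @hRU (b - 1)
          simp only [Finset.mem_filter]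
          tauto
        · intro u hu
          rw [Finset.mem_filter] at hu ⊢
          simpa [hu.1] using hc u hu.1 hu.2
      apply hne
      rw [← Finset.univ_subset_iff, ← huniv]
      exact Finset.filter_subset _ _
    have hu1R : u + 1 ∉ R := fun hc => hu1 (hRU hc)
    by_cases hA : Even R.card
    · by_cases huR : u ∈ R
      · have hpR : u - 1 ∉ R := ((h u).1 huR).2
        have hppR : u - 1 - 1 ∈ R := by
          have := h (u - 1)
          tauto
        refine ⟨u - 1, ⟨u, by simp [mem_cycleNbhd], hu⟩,
          h.sdiff_cycleNbhd (fun _ => by simpa using hu1), ?_⟩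
        have c1 := card_eq_card_sdiff_cycleNbhd R (u - 1)
        have c2 := card_eq_card_sdiff_cycleNbhd (U \ R) (u - 1)
        simp [huR, hpR, hppR, hp] at c1 c2
        simp only [Nat.even_iff] at *
        omega
      · have hu2 : u + 1 + 1 ∉ U := hgap (by simpa using hu) hu1
        have hu2R : u + 1 + 1 ∉ R := fun hc => hu2 (hRU hc)
        refine ⟨u + 1, ⟨u, by simp [mem_cycleNbhd], hu⟩,
          h.sdiff_cycleNbhd (fun hc => absurd hc hu2R), ?_⟩
        have c1 := card_eq_card_sdiff_cycleNbhd R (u + 1)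
        have c2 := card_eq_card_sdiff_cycleNbhd (U \ R) (u + 1)
        simp [huR, hu, hu1, hu1R, hu2, hu2R] at c1 c2
        simp only [Nat.even_iff] at *
        omega
    · refine ⟨u, ⟨u, by simp [mem_cycleNbhd], hu⟩,
        h.sdiff_cycleNbhd (fun hc => absurd hc hu1R), ?_⟩
      have c1 := card_eq_card_sdiff_cycleNbhd R u
      have c2 := card_eq_card_sdiff_cycleNbhd (U \ R) u
      have := h u
      by_cases huR : u ∈ R
      · have hpR : u - 1 ∉ R := (this.1 huR).2
        simp [huR, hpR, hp, hu1, hu1R] at c1 c2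
        simp only [Nat.even_iff] at *
        omega
      · have hpR : u - 1 ∈ R := by tauto
        simp [huR, hpR, hu, hu1, hu1R] at c1 c2
        simp only [Nat.even_iff] at *
        omega

/-- No move preserves the property that both color classes are even. -/
lemma exists_isAlternating_move_odd {S : Finset (Fin (m + 3))} {R : Finset (Fin (m + 3))}
    (h : IsAlternating R (undominated (SimpleGraph.cycleGraph (m + 3)) S))
    (hR : Even R.card)
    (hB : Even (undominated (SimpleGraph.cycleGraph (m + 3)) S \ R).card) {v : Fin (m + 3)}
    (hv : Playable (SimpleGraph.cycleGraph (m + 3)) S v) :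
    ∃ R', IsAlternating R' (undominated (SimpleGraph.cycleGraph (m + 3)) (insert v S)) ∧
      ¬ (Even R'.card ∧
        Even (undominated (SimpleGraph.cycleGraph (m + 3)) (insert v S) \ R').card) := by
  have hne := undominated_ne_univ (Finset.insert_nonempty v S)
  rw [playable_cycle_iff] at hv
  have hgap := @succ_notMem_undominated m S v
  rw [undominated_cycle_insert] at *
  generalize undominated (SimpleGraph.cycleGraph (m + 3)) S = U at *
  have hRU : ∀ {k}, k ∈ R → k ∈ U := fun hk => h.subset hk
  have hv' : v - 1 ∈ U ∨ v ∈ U ∨ v + 1 ∈ U := by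
    obtain ⟨u, hu, hu'⟩ := hv
    rw [mem_cycleNbhd] at hu
    rcases hu with rfl | rfl | rfl <;> tauto
  have hodd : Odd (U.card - (U \ cycleNbhd v).card) →
      ∃ R', IsAlternating R' (U \ cycleNbhd v) ∧
        ¬ (Even R'.card ∧ Even ((U \ cycleNbhd v) \ R').card) := by
    intro ho
    obtain ⟨R', hR'⟩ := exists_isAlternating _ hne
    refine ⟨R', hR', ?_⟩
    have e1 := Finset.card_sdiff_add_card_eq_card hR'.subset
    have e2 := Finset.card_sdiff_add_card_eq_card h.subset
    simp only [Nat.even_iff, Nat.odd_iff] at *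
    omega
  have c1 := card_eq_card_sdiff_cycleNbhd R v
  have c2 := card_eq_card_sdiff_cycleNbhd U v
  have hpair : v + 1 ∉ R → R.card = (R \ cycleNbhd v).card + 1 →
      ∃ R', IsAlternating R' (U \ cycleNbhd v) ∧
        ¬ (Even R'.card ∧ Even ((U \ cycleNbhd v) \ R').card) := by
    intro hx hc
    refine ⟨_, h.sdiff_cycleNbhd (fun hc => absurd hc hx), ?_⟩
    simp only [Nat.even_iff] at *
    omega
  have h0 := h v
  have h1 := h.succ_mem_iff v
  by_cases a : v - 1 ∈ U <;> by_cases b : v ∈ U <;> by_cases c : v + 1 ∈ U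
  · exact hodd (by simp only [a, b, c, if_true] at c2; rw [c2]; simp; decide)
  · have f : v + 1 ∉ R := fun hf => c (hRU hf)
    by_cases d : v ∈ R
    · exact hpair f (by simpa [d, (h0.1 d).2, f] using c1)
    · have e : v - 1 ∈ R := by
        by_contra e
        exact d (h0.2 ⟨b, e⟩)
      exact hpair f (by simpa [d, e, f] using c1)
  · exact absurd c (hgap a b)
  · exact hodd (by simp [a, b, c] at c2; rw [c2]; simp)
  · have d : v - 1 ∉ R := fun hd => a (hRU hd)
    have e : v ∈ R := h0.2 ⟨b, d⟩
    have f : v + 1 ∉ R := fun hf => (h1.1 hf).2 e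
    exact hpair f (by simpa [d, e, f] using c1)
  · exact hodd (by simp [a, b, c] at c2; rw [c2]; simp)
  · exact hodd (by simp [a, b, c] at c2; rw [c2]; simp)
  · simp [a, b, c] at hv'

theorem grundy_cycle_eq_zero_iff {S : Finset (Fin (m + 3))} (hS : S.Nonempty)
    {R : Finset (Fin (m + 3))}
    (h : IsAlternating R (undominated (SimpleGraph.cycleGraph (m + 3)) S)) :
    grundy (SimpleGraph.cycleGraph (m + 3)) S = 0 ↔
      Even R.card ∧ Even (undominated (SimpleGraph.cycleGraph (m + 3)) S \ R).card := by
  induction hk : (Finset.univ \ S).card using Nat.strong_induction_on generalizing S R with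
  | _ k ih =>
    subst hk
    rw [grundy_eq_zero_iff]
    constructor
    · intro hall
      by_contra hodd
      obtain ⟨v, hv, hR', hE⟩ := exists_move_even hS h hodd
      exact hall v hv ((ih _ hv.card_lt (Finset.insert_nonempty v S) hR' rfl).2 hE)
    · rintro ⟨hA, hB⟩ v hv h0
      obtain ⟨R', hR', hE⟩ := exists_isAlternating_move_odd h hA hB hv
      exact hE ((ih _ hv.card_lt (Finset.insert_nonempty v S) hR' rfl).1 h0)

lemma undominated_cycle_empty :
    undominated (SimpleGraph.cycleGraph (m + 3)) ∅ = Finset.univ := by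
  ext u
  simp [mem_undominated, Dominated]

lemma grundy_cycle_singleton_eq_zero_iff (v : Fin (m + 3)) :
    grundy (SimpleGraph.cycleGraph (m + 3)) (insert v ∅) = 0 ↔ m % 4 = 0 := by
  have hne := undominated_ne_univ (Finset.insert_nonempty v ∅)
  obtain ⟨R, hR⟩ := exists_isAlternating _ hne
  rw [grundy_cycle_eq_zero_iff (Finset.insert_nonempty v ∅) hR]
  have e1 := Finset.card_sdiff_add_card_eq_card hR.subset
  have e2 := hR.card_eq
  have e3 : (R.filter fun u => u + 1 ∉
      undominated (SimpleGraph.cycleGraph (m + 3)) (insert v ∅)).card ≤ 1 := by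
    rw [Finset.card_le_one_iff_subset_singleton]
    refine ⟨v - 1 - 1, fun u hu => ?_⟩
    rw [Finset.mem_filter] at hu
    obtain ⟨hu, hu1⟩ := hu
    have hu := hR.subset hu
    simp only [undominated_cycle_insert, undominated_cycle_empty, Finset.mem_sdiff,
      Finset.mem_univ, true_and, not_not, mem_cycleNbhd] at hu hu1
    rw [Finset.mem_singleton]
    rcases hu1 with hc | hc | hc
    · exact eq_sub_of_add_eq hc
    · exact absurd (Or.inl (eq_sub_of_add_eq hc)) hu
    · exact absurd (Or.inr (Or.inl (add_right_cancel hc))) hu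
  have e4 := card_eq_card_sdiff_cycleNbhd (Finset.univ : Finset (Fin (m + 3))) v
  rw [← undominated_cycle_empty, ← undominated_cycle_insert, undominated_cycle_empty] at e4
  simp only [Finset.card_univ, Fintype.card_fin, Finset.mem_univ, if_true] at e4
  simp only [Nat.even_iff]
  omega

end Cycle

theorem grundy_cycle (n : ℕ) (hn : 3 ≤ n) :
    grundy (SimpleGraph.cycleGraph n) ∅ = if n % 4 = 3 then 1 else 0 := by
  obtain ⟨m, rfl⟩ := Nat.exists_eq_add_of_le' hn
  have hplay (v : Fin (m + 3)) : Playable (SimpleGraph.cycleGraph (m + 3)) ∅ v :=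
    ⟨v, Or.inl rfl, by simp [Dominated]⟩
  split_ifs with h
  · exact grundy_eq_one (hplay 0)
      fun v _ => (grundy_cycle_singleton_eq_zero_iff v).2 (by omega)
  · rw [grundy_eq_zero_iff]
    intro v _ hv
    rw [grundy_cycle_singleton_eq_zero_iff] at hv
    omega
end

section
/- For every n ≥ 3, the first player (Alice) has a winning strategy in the Normal Domination Game on the cycle C_n if and only if n % 4 = 3, that is, if and only if n = 4k + 3 for some integer k. -/
open SimpleGraph Finset

/-- The player to move in position `S` has a winning strategy (normal play:
the last player to move wins): some move leads to a position in which the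
opponent, now to move, has no winning strategy. -/
def FirstWins {V : Type} [Fintype V] [DecidableEq V]
    (G : SimpleGraph V) (S : Finset V) : Prop :=
  ∃ v : V, ∃ _ : Playable G S v, ¬ FirstWins G (insert v S)
termination_by (Finset.univ \ S).card
decreasing_by exact Playable.card_lt ‹Playable G S v›

/-- The nimber of a run of `g` unselected vertices between two consecutive selected vertices. -/
def gapRank (g : ℕ) : ℕ := if g < 2 then 0 else (g + 2) % 4

/-- The nimber of a run of `g` unselected vertices, as a pair of binary digits, so that
nim-addition becomes addition. -/
def gapValue (g : ℕ) : ZMod 2 × ZMod 2 := ((gapRank g : ℕ), (gapRank g / 2 : ℕ))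

lemma gapRank_lt (g : ℕ) : gapRank g < 4 := by
  unfold gapRank; split <;> omega

lemma gapValue_eq_zero_iff (g : ℕ) : gapValue g = 0 ↔ gapRank g = 0 := by
  have h := gapRank_lt g
  unfold gapValue
  generalize gapRank g = r at *
  interval_cases r <;> decide

lemma gapValue_add_ne {i j : ℕ} (h : 2 ≤ i + j) :
    gapValue i + gapValue j ≠ gapValue (i + j + 1) := by
  have hi := gapRank_lt i
  have hj := gapRank_lt j
  have hg := gapRank_lt (i + j + 1)
  have key : (gapRank i = 0 ∧ gapRank (i + j + 1) ≠ gapRank j) ∨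
      (gapRank j = 0 ∧ gapRank (i + j + 1) ≠ gapRank i) ∨
      (gapRank i + gapRank j + 3) % 4 = gapRank (i + j + 1) := by
    unfold gapRank; split_ifs <;> omega
  unfold gapValue
  generalize gapRank i = a at *
  generalize gapRank j = b at *
  generalize gapRank (i + j + 1) = c at *
  interval_cases a <;> interval_cases b <;> interval_cases c <;>
    first | (exfalso; omega) | decide

/-- A run of unselected vertices can be split into two runs realising any smaller nimber. -/
lemma exists_gapValue_add_eq (g r : ℕ) (hr : r < gapRank g) :
    ∃ i j, i + j + 1 = g ∧ 2 ≤ i + j ∧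
      gapValue i + gapValue j = (((r : ℕ) : ZMod 2), ((r / 2 : ℕ) : ZMod 2)) := by
  have hg := gapRank_lt g
  have h2 : 3 ≤ g ∧ gapRank g ≤ g - 2 := by
    unfold gapRank at *; split_ifs at * <;> omega
  refine ⟨gapRank g - 1 - r, g - 1 - (gapRank g - 1 - r), by omega, by omega, ?_⟩
  have h0 : gapRank (gapRank g - 1 - r) = 0 := by
    generalize gapRank g = c at *
    unfold gapRank; split_ifs <;> omega
  have h1 : gapRank (g - 1 - (gapRank g - 1 - r)) = r := by
    have : gapRank g = (g + 2) % 4 := by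
      unfold gapRank; split_ifs <;> omega
    generalize gapRank g = c at *
    unfold gapRank; split_ifs <;> omega
  rw [(gapValue_eq_zero_iff _).2 h0, zero_add, gapValue, h1]

/-- Nim's winning move: a nonzero sum has a summand that can be decreased so as to cancel it. -/
lemma exists_mem_rank_lt_of_sum_ne_zero {ι : Type} (S : Finset ι) (f : ι → ℕ)
    (h : ∑ s ∈ S, gapValue (f s) ≠ 0) :
    ∃ s ∈ S, ∃ r < gapRank (f s),
      (((r : ℕ) : ZMod 2), ((r / 2 : ℕ) : ZMod 2)) = gapValue (f s) + ∑ s ∈ S, gapValue (f s) := by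
  generalize hx : ∑ s ∈ S, gapValue (f s) = x at *
  by_cases h2 : x.2 = 0
  · have h1 : x.1 ≠ 0 := fun h1 => h (Prod.ext h1 h2)
    have : ∃ s ∈ S, (gapValue (f s)).1 ≠ 0 := by
      by_contra! hc
      apply h1
      rw [← hx, Prod.fst_sum]
      exact Finset.sum_eq_zero hc
    obtain ⟨s, hs, hne⟩ := this
    refine ⟨s, hs, gapRank (f s) - 1, ?_⟩
    have hlt := gapRank_lt (f s)
    unfold gapValue at *
    generalize gapRank (f s) = c at *
    clear hx
    revert x
    interval_cases c <;> revert hne <;> decide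
  · have : ∃ s ∈ S, (gapValue (f s)).2 ≠ 0 := by
      by_contra! hc
      apply h2
      rw [← hx, Prod.snd_sum]
      exact Finset.sum_eq_zero hc
    obtain ⟨s, hs, hne⟩ := this
    refine ⟨s, hs, ?_⟩
    have hlt := gapRank_lt (f s)
    unfold gapValue at *
    generalize gapRank (f s) = c at *
    clear hx
    revert x
    interval_cases c <;> revert hne <;> decide

section Cycle

open Fin.CommRing

variable {n : ℕ}

/-- Walking forward from `s`, exactly `k` vertices outside `S` precede the next vertex of `S`. -/
def IsGap (S : Finset (Fin (n + 2))) (s : Fin (n + 2)) (k : ℕ) : Prop :=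
  s + k + 1 ∈ S ∧ ∀ t < k, s + t + 1 ∉ S

/-- The number of vertices outside `S` strictly between `s` and the next vertex of `S`. -/
noncomputable def gap (S : Finset (Fin (n + 2))) (s : Fin (n + 2)) : ℕ :=
  sInf {k : ℕ | s + k + 1 ∈ S}

/-- The nim-sum of the values of all runs of unselected vertices. -/
noncomputable def cycleValue (S : Finset (Fin (n + 2))) : ZMod 2 × ZMod 2 :=
  ∑ s ∈ S, gapValue (gap S s)

lemma IsGap.gap_eq {S : Finset (Fin (n + 2))} {s : Fin (n + 2)} {k : ℕ} (h : IsGap S s k) :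
    gap S s = k := by
  apply le_antisymm
  · exact Nat.sInf_le h.1
  · by_contra! hlt
    exact h.2 _ hlt (Nat.sInf_mem (s := {k : ℕ | s + k + 1 ∈ S}) ⟨k, h.1⟩)

lemma isGap_gap {S : Finset (Fin (n + 2))} (hS : S.Nonempty) (s : Fin (n + 2)) :
    IsGap S s (gap S s) := by
  obtain ⟨p, hp⟩ := hS
  refine ⟨Nat.sInf_mem (s := {k : ℕ | s + k + 1 ∈ S}) ⟨(p - s - 1).val, ?_⟩,
    fun t ht hmem => Nat.notMem_of_lt_sInf ht hmem⟩
  have : s + ((p - s - 1).val : Fin (n + 2)) + 1 = p := by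
    rw [Fin.cast_val_eq_self]; ring
  rwa [Set.mem_ofPred_eq, this]

/-- Every vertex has a nearest vertex of a nonempty `S` strictly behind it. -/
lemma exists_pred {S : Finset (Fin (n + 2))} (hS : S.Nonempty) (v : Fin (n + 2)) :
    ∃ p ∈ S, ∃ i : ℕ, p + i + 1 = v ∧ ∀ t < i, p + t + 1 ∉ S := by
  classical
  have hex : ∃ i : ℕ, v - i - 1 ∈ S := by
    obtain ⟨p, hp⟩ := hS
    refine ⟨(v - p - 1).val, ?_⟩
    have : v - ((v - p - 1).val : Fin (n + 2)) - 1 = p := by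
      rw [Fin.cast_val_eq_self]; ring
    rwa [this]
  refine ⟨_, Nat.find_spec hex, Nat.find hex, by ring, fun t ht hmem => ?_⟩
  refine Nat.find_min hex (m := Nat.find hex - 1 - t) (by omega) ?_
  convert hmem using 1
  rw [Nat.cast_sub (by omega), Nat.cast_sub (by omega)]
  push_cast
  ring

/-- Selecting `v` splits the run containing it and leaves the other runs unchanged. -/
lemma cycleValue_insert {S : Finset (Fin (n + 2))} {p v : Fin (n + 2)} {i j : ℕ}
    (hp : p ∈ S) (hv : v ∉ S) (hpv : p + i + 1 = v) (hi : ∀ t < i, p + t + 1 ∉ S)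
    (hj : IsGap S v j) :
    cycleValue (insert v S) + gapValue (i + j + 1) =
      cycleValue S + (gapValue i + gapValue j) := by
  have hgp : gap S p = i + j + 1 := by
    apply IsGap.gap_eq
    refine ⟨?_, fun t ht => ?_⟩
    · convert hj.1 using 1
      rw [← hpv]; push_cast; ring
    · rcases lt_trichotomy t i with h | h | h
      · exact hi t h
      · rw [h, hpv]; exact hv
      · obtain ⟨d, rfl⟩ : ∃ d, t = i + 1 + d := ⟨t - (i + 1), by omega⟩
        have := hj.2 d (by omega)
        rw [← hpv] at this
        convert this using 2
        push_cast; ring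
  have hgp' : gap (insert v S) p = i := by
    apply IsGap.gap_eq
    refine ⟨by rw [hpv]; simp, fun t ht => ?_⟩
    rw [Finset.mem_insert, not_or]
    refine ⟨fun h => ?_, hi t ht⟩
    apply hi (i - 1 - t) (by omega)
    have hcast : p + ((i - 1 - t : ℕ) : Fin (n + 2)) + 1 = p := by
      rw [Nat.cast_sub (by omega), Nat.cast_sub (by omega)]
      push_cast
      linear_combination hpv - h
    rw [hcast]
    exact hp
  have hgv : gap (insert v S) v = j := by
    apply IsGap.gap_eq
    refine ⟨Finset.mem_insert_of_mem hj.1, fun t ht => ?_⟩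
    rw [Finset.mem_insert, not_or]
    refine ⟨fun h => ?_, hj.2 t ht⟩
    apply hj.2 (j - 1 - t) (by omega)
    have hcast : v + ((j - 1 - t : ℕ) : Fin (n + 2)) + 1 = v + j + 1 := by
      rw [Nat.cast_sub (by omega), Nat.cast_sub (by omega)]
      push_cast
      linear_combination -h
    rw [hcast]
    exact hj.1
  have hother : ∀ s ∈ S.erase p, gap (insert v S) s = gap S s := by
    intro s hs
    rw [Finset.mem_erase] at hs
    have hg := isGap_gap ⟨p, hp⟩ s
    apply IsGap.gap_eq
    refine ⟨Finset.mem_insert_of_mem hg.1, fun t ht => ?_⟩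
    rw [Finset.mem_insert, not_or]
    refine ⟨fun h => ?_, hg.2 t ht⟩
    rcases lt_trichotomy t i with hlt | rfl | hlt
    · apply hi (i - t - 1) (by omega)
      have hcast : p + ((i - t - 1 : ℕ) : Fin (n + 2)) + 1 = s := by
        rw [Nat.cast_sub (by omega), Nat.cast_sub (by omega)]
        push_cast
        linear_combination hpv - h
      rw [hcast]
      exact hs.2
    · exact hs.1 (by linear_combination h - hpv)
    · apply hg.2 (t - i - 1) (by omega)
      have hcast : s + ((t - i - 1 : ℕ) : Fin (n + 2)) + 1 = p := by
        rw [Nat.cast_sub (by omega), Nat.cast_sub (by omega)]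
        push_cast
        linear_combination h - hpv
      rw [hcast]
      exact hp
  unfold cycleValue
  rw [Finset.sum_insert hv, ← Finset.add_sum_erase S _ hp, ← Finset.add_sum_erase S _ hp,
    Finset.sum_congr rfl fun s hs => by rw [hother s hs], hgp, hgp', hgv]
  abel

lemma dominated_cycleGraph_iff (S : Finset (Fin (n + 2))) (u : Fin (n + 2)) :
    Dominated (cycleGraph (n + 2)) S u ↔ u ∈ S ∨ u - 1 ∈ S ∨ u + 1 ∈ S := by
  unfold Dominated
  simp only [cycleGraph_adj]
  constructor
  · rintro ⟨s, hs, rfl | h | h⟩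
    · exact Or.inl hs
    · right; right
      rwa [← h, add_sub_cancel]
    · right; left
      rwa [← h, sub_sub_cancel]
  · rintro (h | h | h)
    · exact ⟨u, h, Or.inl rfl⟩
    · exact ⟨_, h, Or.inr (Or.inr (by ring))⟩
    · exact ⟨_, h, Or.inr (Or.inl (by ring))⟩

/-- A vertex in a run of unselected vertices is playable iff the run has length at least 3. -/
lemma playable_cycleGraph_iff {S : Finset (Fin (n + 2))} {p v : Fin (n + 2)} {i j : ℕ}
    (hp : p ∈ S) (hv : v ∉ S) (hpv : p + i + 1 = v) (hi : ∀ t < i, p + t + 1 ∉ S)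
    (hj : IsGap S v j) :
    Playable (cycleGraph (n + 2)) S v ↔ 2 ≤ i + j := by
  constructor
  · rintro ⟨u, hu, hnd⟩
    rw [dominated_cycleGraph_iff] at hnd
    push Not at hnd
    by_contra! hlt
    rw [cycleGraph_adj] at hu
    have hu' : u = v ∨ u = v - 1 ∨ u = v + 1 := by
      rcases hu with h | h | h
      · exact Or.inl h
      · right; left; rw [← h]; ring
      · right; right; rw [← h]; ring
    have hcases : (i = 0 ∧ j = 0) ∨ (i = 0 ∧ j = 1) ∨ (i = 1 ∧ j = 0) := by omega
    have hj1 := hj.1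
    have hpe : p = v - i - 1 := by rw [← hpv]; ring
    subst hpe
    rcases hcases with ⟨rfl, rfl⟩ | ⟨rfl, rfl⟩ | ⟨rfl, rfl⟩ <;>
      rcases hu' with rfl | rfl | rfl <;>
      simp_all [sub_add_cancel]
  · intro h
    have hv1 : 1 ≤ i → v - 1 ∉ S := fun h1 => by
      convert hi (i - 1) (by omega) using 2
      rw [← hpv, Nat.cast_sub h1]; push_cast; ring
    have hv2 : 2 ≤ i → v - 1 - 1 ∉ S := fun h1 => by
      convert hi (i - 2) (by omega) using 2
      rw [← hpv, Nat.cast_sub h1]; push_cast; ring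
    have hw1 : 1 ≤ j → v + 1 ∉ S := fun h1 => by
      simpa using hj.2 0 (by omega)
    have hw2 : 2 ≤ j → v + 1 + 1 ∉ S := fun h1 => by
      simpa using hj.2 1 (by omega)
    simp only [Playable, dominated_cycleGraph_iff, cycleGraph_adj]
    by_cases h1 : i = 0
    · refine ⟨v + 1, Or.inr (Or.inr (by ring)), ?_⟩
      rw [add_sub_cancel_right]
      simp [hv, hw1 (by omega), hw2 (by omega)]
    · by_cases h2 : j = 0
      · refine ⟨v - 1, Or.inr (Or.inl (by ring)), ?_⟩
        rw [sub_add_cancel]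
        simp [hv, hv1 (by omega), hv2 (by omega)]
      · refine ⟨v, Or.inl rfl, ?_⟩
        simp [hv, hv1 (by omega), hw1 (by omega)]

lemma exists_playable_cycleValue_eq_zero {S : Finset (Fin (n + 2))} (hS : S.Nonempty)
    (h : cycleValue S ≠ 0) :
    ∃ v, Playable (cycleGraph (n + 2)) S v ∧ cycleValue (insert v S) = 0 := by
  obtain ⟨p, hp, r, hr, hval⟩ := exists_mem_rank_lt_of_sum_ne_zero S (gap S) h
  obtain ⟨i, j, hij, h2, hsum⟩ := exists_gapValue_add_eq _ _ hr
  have hg := isGap_gap hS p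
  rw [← hij] at hg
  have hv : p + i + 1 ∉ S := hg.2 i (by omega)
  have hi : ∀ t < i, p + t + 1 ∉ S := fun t ht => hg.2 t (by omega)
  have hj : IsGap S (p + i + 1) j := by
    refine ⟨?_, fun t ht => ?_⟩
    · convert hg.1 using 1
      push_cast; ring
    · convert hg.2 (i + t + 1) (by omega) using 2
      push_cast; ring
  refine ⟨p + i + 1, (playable_cycleGraph_iff hp hv rfl hi hj).2 h2, ?_⟩
  have key := cycleValue_insert hp hv rfl hi hj
  rw [hsum, hval, ← hij] at key
  change _ = cycleValue S + (_ + cycleValue S) at key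
  have hdouble : ∀ x : ZMod 2 × ZMod 2, x + x = 0 := by decide
  have : cycleValue (insert (p + i + 1) S) + gapValue (i + j + 1) =
      0 + gapValue (i + j + 1) := by
    rw [key, ← hdouble (cycleValue S)]
    abel
  exact add_right_cancel this

lemma cycleValue_insert_ne {S : Finset (Fin (n + 2))} (hS : S.Nonempty) {v : Fin (n + 2)}
    (hplay : Playable (cycleGraph (n + 2)) S v) : cycleValue (insert v S) ≠ cycleValue S := by
  have hv := hplay.not_mem
  obtain ⟨p, hp, i, hpv, hi⟩ := exists_pred hS v
  have hj := isGap_gap hS v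
  have h2 := (playable_cycleGraph_iff hp hv hpv hi hj).1 hplay
  intro heq
  have key := cycleValue_insert hp hv hpv hi hj
  rw [heq] at key
  exact gapValue_add_ne h2 (add_left_cancel key).symm

theorem firstWins_cycleGraph_iff_cycleValue_ne_zero (S : Finset (Fin (n + 2)))
    (hS : S.Nonempty) : FirstWins (cycleGraph (n + 2)) S ↔ cycleValue S ≠ 0 := by
  induction hc : (Finset.univ \ S).card using Nat.strong_induction_on generalizing S with
  | _ c ih =>
    subst hc
    rw [FirstWins]
    constructor
    · rintro ⟨v, hplay, hlose⟩ h0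
      rw [ih _ hplay.card_lt _ (Finset.insert_nonempty _ _) rfl, not_not] at hlose
      exact cycleValue_insert_ne hS hplay (hlose.trans h0.symm)
    · intro h
      obtain ⟨v, hplay, h0⟩ := exists_playable_cycleValue_eq_zero hS h
      refine ⟨v, hplay, ?_⟩
      rw [ih _ hplay.card_lt _ (Finset.insert_nonempty _ _) rfl, not_not]
      exact h0

lemma cycleValue_singleton (v : Fin (n + 2)) : cycleValue {v} = gapValue (n + 1) := by
  rw [cycleValue, Finset.sum_singleton, IsGap.gap_eq]
  have hcast (t : ℕ) : v + t + 1 = v ↔ n + 2 ∣ t + 1 := by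
    rw [← Fin.natCast_eq_zero, add_assoc, add_eq_left]
    push_cast
    rfl
  refine ⟨?_, fun t ht => ?_⟩
  · rw [Finset.mem_singleton, hcast]
  · rw [Finset.mem_singleton, hcast]
    exact fun h => absurd (Nat.le_of_dvd (by omega) h) (by omega)

lemma firstWins_cycleGraph_empty_iff :
    FirstWins (cycleGraph (n + 2)) ∅ ↔ gapRank (n + 1) = 0 := by
  have hlose (v : Fin (n + 2)) :
      ¬ FirstWins (cycleGraph (n + 2)) (insert v ∅) ↔ gapRank (n + 1) = 0 := by
    rw [firstWins_cycleGraph_iff_cycleValue_ne_zero _ (Finset.insert_nonempty _ _), not_not,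
      insert_empty_eq, cycleValue_singleton, gapValue_eq_zero_iff]
  rw [FirstWins]
  constructor
  · rintro ⟨v, -, h⟩
    exact (hlose v).1 h
  · exact fun h => ⟨0, ⟨0, Or.inl rfl, by simp [Dominated]⟩, (hlose 0).2 h⟩

end Cycle

theorem firstWins_cycle_iff (n : ℕ) (hn : 3 ≤ n) :
    (FirstWins (SimpleGraph.cycleGraph n) ∅ ↔ n % 4 = 3) ∧
    (FirstWins (SimpleGraph.cycleGraph n) ∅ ↔ ∃ k : ℕ, n = 4 * k + 3) := by
  have hmod : FirstWins (SimpleGraph.cycleGraph n) ∅ ↔ n % 4 = 3 := by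
    obtain ⟨m, rfl⟩ : ∃ m, n = m + 2 := ⟨n - 2, by omega⟩
    rw [firstWins_cycleGraph_empty_iff, gapRank, if_neg (by omega)]
    omega
  refine ⟨hmod, hmod.trans ⟨fun h => ⟨n / 4, by omega⟩, ?_⟩⟩
  rintro ⟨k, rfl⟩
  omega
end
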